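/- For every integer k ≥ 1 and every finite simple graph G on n vertices whose girth is strictly greater than 2k (this includes acyclic graphs, whose girth is infinite), the number of edges of G is at most n^{1+1/k} + n. -/

import Mathlib

open SimpleGraph

/-- Two paths with the same endpoints whose total length is smaller than the extended girth
coincide. -/
theorem SimpleGraph.Walk.IsPath.eq_of_length_add_length_lt_egirth {V : Type*} {G : SimpleGraph V}
    {u v : V} {p q : G.Walk u v} (hp : p.IsPath) (hq : q.IsPath)
    (h : ((p.length + q.length : ℕ) : ℕ∞) < G.egirth) : p = q := by
  classical
  set H : SimpleGraph V := fromEdgeSet {e | e ∈ p.edges ++ q.edges}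
  have mem_edgeSet : ∀ e ∈ p.edges ++ q.edges, e ∈ H.edgeSet := fun e he ↦ by
    have : e ∈ G.edgeSet := (List.mem_append.1 he).elim
      (fun h ↦ p.edges_subset_edgeSet h) (fun h ↦ q.edges_subset_edgeSet h)
    rw [edgeSet_fromEdgeSet]
    exact ⟨he, G.not_isDiag_of_mem_edgeSet this⟩
  have of_mem_edgeSet : ∀ e ∈ H.edgeSet, e ∈ p.edges ++ q.edges := fun e he ↦ by
    rw [edgeSet_fromEdgeSet] at he
    exact he.1
  have acyclic : H.IsAcyclic := fun a c hc ↦ by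
    have hcG : ∀ e ∈ c.edges, e ∈ G.edgeSet := fun e he ↦
      (List.mem_append.1 (of_mem_edgeSet e (c.edges_subset_edgeSet he))).elim
        (fun h ↦ p.edges_subset_edgeSet h) (fun h ↦ q.edges_subset_edgeSet h)
    have hle := egirth_le_length (hc.transfer hcG)
    rw [Walk.length_transfer] at hle
    have hlen : c.length ≤ p.length + q.length := by
      have := (hc.edges_nodup.subperm fun e he ↦
        of_mem_edgeSet e (c.edges_subset_edgeSet he)).length_le
      simpa using this
    exact absurd (h.trans_le hle) (not_lt.2 (by exact_mod_cast hlen))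
  have hpH : ∀ e ∈ p.edges, e ∈ H.edgeSet := fun e he ↦
    mem_edgeSet e (List.mem_append_left _ he)
  have hqH : ∀ e ∈ q.edges, e ∈ H.edgeSet := fun e he ↦
    mem_edgeSet e (List.mem_append_right _ he)
  have key := (acyclic.subsingleton_path u v).elim ⟨_, hp.transfer hpH⟩ ⟨_, hq.transfer hqH⟩
  have := congrArg (fun r : H.Path u v ↦ (r : H.Walk u v).support) key
  simp only [Walk.support_transfer] at this
  exact Walk.ext_support this

/-- The neighbour of the starting vertex of a short path is off the path, unless it is the second
vertex of the path. -/
theorem SimpleGraph.Walk.IsPath.notMem_support_of_ne_snd {V : Type*} {G : SimpleGraph V}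
    {u v x : V} {p : G.Walk u v} (hp : p.IsPath) (hux : G.Adj u x) (hx : x ≠ p.snd)
    (h : ((p.length + 1 : ℕ) : ℕ∞) < G.egirth) : x ∉ p.support := by
  classical
  intro hmem
  have hpath : (Walk.cons hux Walk.nil).IsPath := by simp [hux.ne]
  have heq : p.takeUntil x hmem = Walk.cons hux Walk.nil :=
    (hp.takeUntil hmem).eq_of_length_add_length_lt_egirth hpath <| by
      refine lt_of_le_of_lt ?_ h
      have := p.length_takeUntil_le_length hmem
      simpa using this
  have := p.snd_takeUntil hux.ne' hmem
  rw [heq] at this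
  exact hx (by simpa using this)

/-- The Moore bound, in the weak form: a finite graph with all degrees greater than `d` and girth
greater than `2 * k` has at least `d ^ k` vertices. -/
theorem SimpleGraph.pow_le_card_of_lt_egirth {V : Type*} [Fintype V] [Nonempty V]
    (G : SimpleGraph V) [DecidableRel G.Adj] {d k : ℕ} (hd : ∀ v, d + 1 ≤ G.degree v)
    (hk : ((2 * k : ℕ) : ℕ∞) < G.egirth) : d ^ k ≤ Fintype.card V := by
  classical
  obtain ⟨v⟩ := ‹Nonempty V›
  let sphere (j : ℕ) : Finset V := {u | ∃ p : G.Walk u v, p.IsPath ∧ p.length = j}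
  suffices ∀ j ≤ k, d ^ j ≤ (sphere j).card from
    (this k le_rfl).trans (Finset.card_le_univ _)
  intro j
  induction j with
  | zero =>
    intro _
    rw [pow_zero, Nat.one_le_iff_ne_zero, Finset.card_ne_zero]
    exact ⟨v, by simp [sphere]⟩
  | succ j ih =>
    intro hj
    have hpath : ∀ u ∈ sphere j, ∃ x, ∃ p : G.Walk u v, p.IsPath ∧ p.length = j ∧ p.snd = x := by
      simp [sphere]
    choose! next hnext using hpath
    have hshort {i : ℕ} (hi : i ≤ 2 * k) : (i : ℕ∞) < G.egirth :=
      lt_of_le_of_lt (by exact_mod_cast hi) hk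
    have hcons {u x : V} (hu : u ∈ sphere j) (hx : x ∈ (G.neighborFinset u).erase (next u)) :
        ∃ q : G.Walk x v, q.IsPath ∧ q.length = j + 1 ∧ q.snd = u := by
      rw [Finset.mem_erase, mem_neighborFinset] at hx
      obtain ⟨p, hp, hlen, hsnd⟩ := hnext u hu
      rw [← hsnd] at hx
      exact ⟨Walk.cons hx.2.symm p, hp.cons <| hp.notMem_support_of_ne_snd hx.2 hx.1 <|
        hshort (by lia), by simp [hlen], by simp⟩
    have hdisj : (sphere j : Set V).PairwiseDisjoint
        fun u ↦ (G.neighborFinset u).erase (next u) := by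
      intro u hu w hw huw
      refine Finset.disjoint_left.2 fun x hxu hxw ↦ huw ?_
      obtain ⟨p, hp, hplen, rfl⟩ := hcons hu hxu
      obtain ⟨q, hq, hqlen, rfl⟩ := hcons hw hxw
      rw [hp.eq_of_length_add_length_lt_egirth hq (hshort (by lia))]
    calc d ^ (j + 1) = d ^ j * d := pow_succ d j
      _ ≤ (sphere j).card * d := Nat.mul_le_mul_right _ (ih (by lia))
      _ ≤ ∑ u ∈ sphere j, ((G.neighborFinset u).erase (next u)).card := by
        refine Finset.card_nsmul_le_sum _ _ _ fun u _ ↦ ?_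
        have := Finset.pred_card_le_card_erase (s := G.neighborFinset u) (a := next u)
        have := hd u
        rw [← card_neighborFinset_eq_degree] at this
        lia
      _ = ((sphere j).biUnion fun u ↦ (G.neighborFinset u).erase (next u)).card :=
        (Finset.card_biUnion hdisj).symm
      _ ≤ (sphere (j + 1)).card := by
        refine Finset.card_le_card fun x hx ↦ ?_
        obtain ⟨u, hu, hxu⟩ := Finset.mem_biUnion.1 hx
        obtain ⟨q, hq, hlen, -⟩ := hcons hu hxu
        simpa [sphere] using ⟨q, hq, hlen⟩

/-- In a nonempty finite graph on `n` vertices with girth greater than `2 * k`, some vertex has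
degree at most `n ^ (1 / k) + 1`. -/
theorem SimpleGraph.exists_degree_le_of_lt_egirth {V : Type*} [Fintype V] [Nonempty V]
    (G : SimpleGraph V) [DecidableRel G.Adj] {k : ℕ} (hk0 : k ≠ 0)
    (hk : ((2 * k : ℕ) : ℕ∞) < G.egirth) :
    ∃ v, (G.degree v : ℝ) ≤ (Fintype.card V : ℝ) ^ (1 / (k : ℝ)) + 1 := by
  by_contra! hdeg
  set r : ℝ := (Fintype.card V : ℝ) ^ (1 / (k : ℝ))
  have hr : 0 ≤ r := by positivity
  have hrk : r ^ k = Fintype.card V := by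
    rw [← Real.rpow_natCast, ← Real.rpow_mul (by positivity), one_div_mul_cancel (by simpa),
      Real.rpow_one]
  obtain ⟨v, hv⟩ := G.exists_minimal_degree_vertex
  have hpos : 1 ≤ G.minDegree := by
    have := hdeg v
    rw [← hv] at this
    exact_mod_cast (show (1 : ℝ) ≤ (G.minDegree : ℝ) by linarith)
  have hmoore := G.pow_le_card_of_lt_egirth (d := G.minDegree - 1)
    (fun w ↦ by have := G.minDegree_le_degree w; lia) hk
  have hlt : r < (G.minDegree - 1 : ℕ) := by
    have := hdeg v
    rw [← hv] at this
    push_cast [hpos]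
    linarith
  have := pow_lt_pow_left₀ hlt hr hk0
  rw [hrk] at this
  exact absurd hmoore (not_le.2 (by exact_mod_cast this))

/-- A finite graph on `n` vertices, possibly acyclic, with extended girth greater than `2 * k` has
at most `n * (n ^ (1 / k) + 1)` edges. -/
theorem SimpleGraph.card_edgeFinset_le_of_lt_egirth {V : Type*} [Fintype V]
    (G : SimpleGraph V) [DecidableRel G.Adj] {k : ℕ} (hk0 : k ≠ 0)
    (hk : ((2 * k : ℕ) : ℕ∞) < G.egirth) :
    (G.edgeFinset.card : ℝ) ≤
      Fintype.card V * ((Fintype.card V : ℝ) ^ (1 / (k : ℝ)) + 1) := by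
  classical
  induction hn : Fintype.card V generalizing V with
  | zero =>
    have := Fintype.card_eq_zero_iff.1 hn
    simp [Finset.eq_empty_of_isEmpty]
  | succ n ih =>
    have : Nonempty V := Fintype.card_pos_iff.1 (by lia)
    obtain ⟨v, hv⟩ := G.exists_degree_le_of_lt_egirth hk0 hk
    rw [hn] at hv
    have hcard : Fintype.card ({v}ᶜ : Set V) = n := by
      rw [Fintype.card_compl_set, hn, Fintype.card_unique, Nat.add_sub_cancel]
    have hrec := ih (G.induce {v}ᶜ)
      (hk.trans_le (IsContained.egirth_le ⟨Copy.induce G {v}ᶜ⟩)) hcard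
    rw [card_edgeFinset_induce_compl_singleton, card_edgeFinset_deleteIncidenceSet] at hrec
    have hsplit : (G.edgeFinset.card : ℝ) ≤ (G.edgeFinset.card - G.degree v : ℕ) + G.degree v := by
      exact_mod_cast le_tsub_add
    have hmono : (n : ℝ) ^ (1 / (k : ℝ)) ≤ ((n + 1 : ℕ) : ℝ) ^ (1 / (k : ℝ)) := by
      gcongr
      lia
    calc (G.edgeFinset.card : ℝ)
        ≤ n * ((n : ℝ) ^ (1 / (k : ℝ)) + 1) + (((n + 1 : ℕ) : ℝ) ^ (1 / (k : ℝ)) + 1) := by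
          linarith
      _ ≤ n * (((n + 1 : ℕ) : ℝ) ^ (1 / (k : ℝ)) + 1)
          + (((n + 1 : ℕ) : ℝ) ^ (1 / (k : ℝ)) + 1) := by gcongr
      _ = ((n + 1 : ℕ) : ℝ) * (((n + 1 : ℕ) : ℝ) ^ (1 / (k : ℝ)) + 1) := by
          push_cast; ring

/-- A finite simple graph on `n` vertices whose girth is strictly greater than `2k`
(including acyclic graphs, whose girth is `∞`) has at most `n^{1+1/k} + n` edges. -/
theorem edge_bound_of_large_girth (k : ℕ) (hk : 1 ≤ k) (V : Type) [Fintype V]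
    (G : SimpleGraph V) (hgirth : (2 * k : ℕ∞) < G.girth) :
    (Nat.card G.edgeSet : ℝ) ≤
      (Fintype.card V : ℝ) ^ ((1 : ℝ) + 1 / (k : ℝ)) + (Fintype.card V : ℝ) := by
  classical
  have hlt : ((2 * k : ℕ) : ℕ∞) < G.egirth := by
    push_cast
    exact hgirth.trans_le G.egirth.natCast_toNat_le_self
  have h := G.card_edgeFinset_le_of_lt_egirth (by lia) hlt
  rw [Nat.card_eq_fintype_card, ← edgeFinset_card,
    Real.rpow_add_of_nonneg (by positivity) zero_le_one (by positivity), Real.rpow_one]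
  linarith
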